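/- For every countable discrete group G with Kazhdan's Property (T), there exists a finitely presented group G₀ with Kazhdan's Property (T) and a surjective group homomorphism from G₀ onto G. -/

import Mathlib

/-- A group has Kazhdan's Property (T) if every action by affine isometries on a
real Hilbert space has a fixed point. -/
def PropertyT (G : Type*) [Group G] : Prop :=
  ∀ (H : Type) [NormedAddCommGroup H] [InnerProductSpace ℝ H] [CompleteSpace H]
    (ρ : G →* (H ≃ᵃⁱ[ℝ] H)), ∃ x : H, ∀ g : G, ρ g x = x

/-- A group is finitely presented if it admits a presentation with finitely many
generators and finitely many relations. -/
def FinitelyPresented (G : Type*) [Group G] : Prop :=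
  ∃ (n : ℕ) (rels : Set (FreeGroup (Fin n))), rels.Finite ∧
    Nonempty (PresentedGroup rels ≃* G)

/-- The word length of `g` with respect to a generating set `S`: the least length of a
word in elements of `S ∪ S⁻¹` whose product is `g`. -/
noncomputable def wordLength {G : Type*} [Group G] (S : Set G) (g : G) : ℕ :=
  sInf {n : ℕ | ∃ w : List G, w.length = n ∧ (∀ x ∈ w, x ∈ S ∨ x⁻¹ ∈ S) ∧ w.prod = g}

/-- The word metric on a group with respect to a generating set `S`. -/
noncomputable def wordDist {G : Type*} [Group G] (S : Set G) (x y : G) : ℝ :=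
  (wordLength S (x⁻¹ * y) : ℝ)

/-- The Gromov product of `x` and `y` based at `p`, for the word metric. -/
noncomputable def gromovProd {G : Type*} [Group G] (S : Set G) (p x y : G) : ℝ :=
  (wordDist S p x + wordDist S p y - wordDist S x y) / 2

/-- A group is word hyperbolic if it has a finite generating set whose associated
word metric is Gromov hyperbolic (four-point condition on Gromov products). -/
def IsWordHyperbolic (G : Type*) [Group G] : Prop :=
  ∃ S : Finset G, Subgroup.closure (S : Set G) = ⊤ ∧
    ∃ δ : ℝ, 0 ≤ δ ∧ ∀ p x y z : G,
      min (gromovProd (S : Set G) p x z) (gromovProd (S : Set G) p z y) - δ ≤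
        gromovProd (S : Set G) p x y

open Filter Topology

section Isometries

/-- An action by isometries, given by its action maps, as a homomorphism to the isometry group. -/
def isometryActionHom {G W : Type*} [Group G] [PseudoEMetricSpace W] (T : G → W → W)
    (h_one : ∀ x, T 1 x = x) (h_mul : ∀ g h x, T (g * h) x = T g (T h x))
    (h_iso : ∀ g, Isometry (T g)) : G →* (W ≃ᵢ W) where
  toFun g :=
    { toFun := T g
      invFun := T g⁻¹
      left_inv := fun x => by rw [← h_mul, inv_mul_cancel, h_one]
      right_inv := fun x => by rw [← h_mul, mul_inv_cancel, h_one]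
      isometry_toFun := h_iso g }
  map_one' := IsometryEquiv.ext h_one
  map_mul' g h := IsometryEquiv.ext (h_mul g h)

@[simp]
theorem isometryActionHom_apply {G W : Type*} [Group G] [PseudoEMetricSpace W] (T : G → W → W)
    (h_one : ∀ x, T 1 x = x) (h_mul : ∀ g h x, T (g * h) x = T g (T h x))
    (h_iso : ∀ g, Isometry (T g)) (g : G) (x : W) :
    isometryActionHom T h_one h_mul h_iso g x = T g x := rfl

/-- By the Mazur–Ulam theorem, in Property (T) it does not matter whether actions are assumed
to be affine. -/
theorem PropertyT.exists_fixedPoint {G : Type*} [Group G] (hG : PropertyT G) {W : Type}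
    [NormedAddCommGroup W] [InnerProductSpace ℝ W] [CompleteSpace W] (ρ : G →* (W ≃ᵢ W)) :
    ∃ x, ∀ g, ρ g x = x :=
  hG W
    { toFun := fun g => (ρ g).toRealAffineIsometryEquiv
      map_one' := by ext x; simp
      map_mul' := fun g h => by ext x; simp }

end Isometries

section FiniteGeneration

variable {G : Type*} [Group G]

/-- A function that is moved by every group element by a square-summable amount is at
square-summable distance from an invariant function, if the group has Property (T). -/
theorem PropertyT.exists_invariant_of_memℓp (hG : PropertyT G) {X : Type} [MulAction G X]
    (ξ : X → ℝ) (hξ : ∀ g : G, Memℓp (fun x => ξ (g⁻¹ • x) - ξ x) 2) :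
    ∃ u : X → ℝ, (∀ (g : G) x, u (g • x) = u x) ∧ Memℓp (fun x => u x - ξ x) 2 := by
  have h_two : 0 < (2 : ENNReal).toReal := by norm_num
  have h_comp (g : G) {f : X → ℝ} (hf : Memℓp f 2) : Memℓp (fun x => f (g⁻¹ • x)) 2 := by
    have h_sum := hf.summable h_two
    rw [← (MulAction.toPerm g⁻¹).summable_iff] at h_sum
    exact memℓp_gen h_sum
  let T : G → lp (fun _ : X => ℝ) 2 → lp (fun _ : X => ℝ) 2 := fun g f =>
    ⟨fun x => f (g⁻¹ • x) + (ξ (g⁻¹ • x) - ξ x), (h_comp g (lp.memℓp f)).add (hξ g)⟩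
  have hT (g : G) (f) (x : X) : T g f x = f (g⁻¹ • x) + (ξ (g⁻¹ • x) - ξ x) := rfl
  have h_iso (g : G) : Isometry (T g) := by
    refine Isometry.of_dist_eq fun f f' => ?_
    rw [dist_eq_norm, dist_eq_norm, lp.norm_eq_tsum_rpow h_two, lp.norm_eq_tsum_rpow h_two]
    congr 1
    rw [← (MulAction.toPerm g⁻¹).tsum_eq fun x => ‖(f - f') x‖ ^ (2 : ENNReal).toReal]
    refine tsum_congr fun x => ?_
    simp only [hT, lp.coeFn_sub, Pi.sub_apply, add_sub_add_right_eq_sub]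
    rfl
  obtain ⟨f, hf⟩ := hG.exists_fixedPoint (isometryActionHom T
    (fun f => by ext x; simp [hT])
    (fun g h f => by ext x; simp only [hT, mul_inv_rev, mul_smul]; ring) h_iso)
  refine ⟨fun x => f x + ξ x, fun g x => ?_, by simpa using lp.memℓp f⟩
  have := congrArg (fun f : lp (fun _ : X => ℝ) 2 => f (g • x)) (hf g)
  simp only [isometryActionHom_apply, hT, inv_smul_smul] at this
  linarith

/-- A finitely generated subgroup of a group that is not finitely generated has infinite index. -/
theorem Subgroup.infinite_quotient_of_fg (hG : ¬ Group.FG G) {K : Subgroup G} (hK : K.FG) :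
    Infinite (G ⧸ K) := by
  by_contra h_fin
  rw [not_infinite_iff_finite] at h_fin
  obtain ⟨S, hS⟩ := hK
  refine hG ((Group.fg_iff).mpr
    ⟨S ∪ Set.range (Quotient.out : G ⧸ K → G), ?_, S.finite_toSet.union (Set.finite_range _)⟩)
  refine (Subgroup.eq_top_iff' _).mpr fun g => ?_
  have h_le : K ≤ Subgroup.closure (S ∪ Set.range (Quotient.out : G ⧸ K → G)) :=
    hS ▸ Subgroup.closure_mono Set.subset_union_left
  have h_mem : (Quotient.out (g : G ⧸ K))⁻¹ * g ∈ K := by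
    rw [← QuotientGroup.eq]
    exact Quotient.out_eq _
  have h_out : Quotient.out (g : G ⧸ K) ∈
      Subgroup.closure (S ∪ Set.range (Quotient.out : G ⧸ K → G)) :=
    Subgroup.subset_closure (Or.inr ⟨(g : G ⧸ K), rfl⟩)
  simpa using mul_mem h_out (h_le h_mem)

/-- Countable groups with Property (T) are finitely generated. -/
theorem PropertyT.group_fg {G : Type} [Group G] [Countable G] (hG : PropertyT G) :
    Group.FG G := by
  by_contra h_fg
  obtain ⟨e, he⟩ := exists_surjective_nat G
  let K : ℕ → Subgroup G := fun n => Subgroup.closure (e '' Set.Iio n)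
  have hK (n : ℕ) : (K n).FG :=
    (Subgroup.fg_iff _).mpr ⟨_, rfl, (Set.finite_Iio n).image e⟩
  have h_inf (n : ℕ) : Infinite (G ⧸ K n) := Subgroup.infinite_quotient_of_fg h_fg (hK n)
  have h_two : 0 < (2 : ENNReal).toReal := by norm_num
  classical
  let base : ℕ → Σ n, G ⧸ K n := fun n => ⟨n, (1 : G)⟩
  have h_base : Function.Injective base := fun m n h => congrArg Sigma.fst h
  let ξ : (Σ n, G ⧸ K n) → ℝ := Set.indicator (Set.range base) 1
  have hξ_base (n : ℕ) : ξ (base n) = 1 := by simp [ξ]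
  have hξ_ne (n : ℕ) (y : G ⧸ K n) (hy : y ≠ (1 : G)) : ξ ⟨n, y⟩ = 0 := by
    refine Set.indicator_of_notMem ?_ _
    rintro ⟨m, hm⟩
    obtain rfl : m = n := congrArg Sigma.fst hm
    exact hy (eq_of_heq (Sigma.mk.inj hm).2).symm
  have h_supp (g : G) : ∃ N, ∀ n, N ≤ n → ∀ y : G ⧸ K n, ξ (g⁻¹ • ⟨n, y⟩) = ξ ⟨n, y⟩ := by
    obtain ⟨i, hi⟩ := he g
    refine ⟨i + 1, fun n hn y => ?_⟩
    have hg : g ∈ K n := Subgroup.subset_closure ⟨i, by simpa using hn, hi⟩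
    have h_fix : g • ((1 : G) : G ⧸ K n) = (1 : G) := by
      rw [MulAction.Quotient.smul_coe, eq_comm, QuotientGroup.eq]
      simpa using hg
    rw [Sigma.smul_mk]
    by_cases hy : y = (1 : G)
    · rw [hy, inv_smul_eq_iff.mpr h_fix.symm]
    · rw [hξ_ne n y hy, hξ_ne n _ (fun h => hy ?_)]
      rw [inv_smul_eq_iff, h_fix] at h
      exact h
  obtain ⟨u, hu, hu_mem⟩ := hG.exists_invariant_of_memℓp ξ fun g => by
    obtain ⟨N, hN⟩ := h_supp g
    refine (memℓp_zero ?_).of_exponent_ge zero_le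
    refine (((Set.finite_Iio N).image base).union
      ((Set.finite_Iio N).image fun n => g • base n)).subset ?_
    rintro ⟨n, y⟩ hy
    have hn : n < N := by
      by_contra! hn
      exact hy (by rw [hN n hn, sub_self])
    by_cases h1 : y = (1 : G)
    · exact Or.inl ⟨n, hn, by rw [h1]⟩
    · refine Or.inr ⟨n, hn, ?_⟩
      by_contra h2
      refine hy ?_
      rw [hξ_ne n y h1, Sigma.smul_mk, hξ_ne n, sub_zero]
      intro h3
      rw [inv_smul_eq_iff] at h3
      exact h2 (by rw [h3]; rfl)
  have h_tendsto := ((memℓp_gen_iff h_two).mp hu_mem).tendsto_cofinite_zero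
  have h_const (n : ℕ) (y : G ⧸ K n) : u ⟨n, y⟩ = u (base n) := by
    obtain ⟨g, rfl⟩ := QuotientGroup.mk_surjective y
    rw [← hu g (base n), Sigma.smul_mk, MulAction.Quotient.smul_coe, smul_eq_mul, mul_one]
  have hu_zero (n : ℕ) : u (base n) = 0 := by
    have h_lim := h_tendsto.comp (sigma_mk_injective (i := n)).tendsto_cofinite
    have h_ev : ∀ᶠ y : G ⧸ K n in cofinite, y ≠ (1 : G) :=
      (Set.finite_singleton _).compl_mem_cofinite
    have h_lim' : Tendsto (fun _ : G ⧸ K n => ‖u (base n)‖ ^ (2 : ENNReal).toReal) cofinite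
        (𝓝 0) := by
      refine h_lim.congr' (h_ev.mono fun y hy => ?_)
      rw [Function.comp_apply, h_const, hξ_ne n y hy, sub_zero]
    have h_pow := tendsto_nhds_unique tendsto_const_nhds h_lim'
    rwa [Real.rpow_eq_zero (norm_nonneg _) h_two.ne', norm_eq_zero] at h_pow
  have h_lim := h_tendsto.comp h_base.tendsto_cofinite
  have : Tendsto (fun _ : ℕ => (1 : ℝ)) cofinite (𝓝 0) := by
    refine h_lim.congr fun n => ?_
    simp [hu_zero, hξ_base]
  exact one_ne_zero (tendsto_nhds_unique tendsto_const_nhds this)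

end FiniteGeneration

section Ultraproduct

variable {ι : Type*}

theorem Ultrafilter.exists_tendsto_of_bounded (U : Ultrafilter ι) {f : ι → ℝ} {C : ℝ}
    (hf : ∀ i, |f i| ≤ C) : ∃ l, Tendsto f U (𝓝 l) := by
  obtain ⟨l, -, hl⟩ := (isCompact_Icc (a := -C) (b := C)).ultrafilter_le_nhds (U.map f)
    (le_principal_iff.mpr (Filter.mem_map.mpr (univ_mem' fun i => abs_le.mp (hf i))))
  exact ⟨l, hl⟩

/-- Bounded families in a family of normed spaces; a type synonym of `lp H ∞` carrying the
semi-inner product given by the limit along an ultrafilter. -/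
def BoundedFamily (H : ι → Type*) [∀ i, NormedAddCommGroup (H i)] (_ : Ultrafilter ι) :
    Type _ :=
  lp H ⊤

namespace BoundedFamily

variable {H : ι → Type*} [∀ i, NormedAddCommGroup (H i)] {U : Ultrafilter ι}

noncomputable instance : AddCommGroup (BoundedFamily H U) :=
  inferInstanceAs (AddCommGroup (lp H ⊤))

instance : CoeFun (BoundedFamily H U) fun _ => ∀ i, H i :=
  ⟨fun x => x.1⟩

theorem exists_norm_le (x : BoundedFamily H U) : ∃ C, ∀ i, ‖x i‖ ≤ C := by
  obtain ⟨C, hC⟩ := (memℓp_infty_iff.mp x.2).exists_ge 0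
  exact ⟨C, fun i => hC.2 _ ⟨i, rfl⟩⟩

/-- The bounded family with given members. -/
def mk (f : ∀ i, H i) (hf : ∃ C, ∀ i, ‖f i‖ ≤ C) : BoundedFamily H U :=
  ⟨f, memℓp_infty (hf.imp fun _ hC => by rintro _ ⟨i, rfl⟩; exact hC i)⟩

theorem mk_apply (f : ∀ i, H i) (hf : ∃ C, ∀ i, ‖f i‖ ≤ C) (i : ι) :
    (mk f hf : BoundedFamily H U) i = f i := rfl

theorem add_apply (x y : BoundedFamily H U) (i : ι) : (x + y) i = x i + y i := rfl

theorem sub_apply (x y : BoundedFamily H U) (i : ι) : (x - y) i = x i - y i := rfl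

@[ext]
theorem ext {x y : BoundedFamily H U} (h : ∀ i, x i = y i) : x = y :=
  Subtype.ext (funext h)

/-- Isometries of the members moving the origins by a bounded amount act on bounded families. -/
noncomputable def map (T : ∀ i, H i ≃ᵢ H i) (hT : ∃ C, ∀ i, ‖T i 0‖ ≤ C)
    (x : BoundedFamily H U) : BoundedFamily H U :=
  mk (fun i => T i (x i)) <| by
    obtain ⟨C, hC⟩ := hT
    obtain ⟨D, hD⟩ := x.exists_norm_le
    refine ⟨D + C, fun i => ?_⟩
    calc ‖T i (x i)‖ ≤ dist (T i (x i)) (T i 0) + ‖T i 0‖ := by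
          simpa [dist_eq_norm] using norm_add_le (T i (x i) - T i 0) (T i 0)
      _ ≤ D + C := by
          rw [(T i).dist_eq, dist_zero_right]
          exact add_le_add (hD i) (hC i)

theorem map_apply (T : ∀ i, H i ≃ᵢ H i) (hT : ∃ C, ∀ i, ‖T i 0‖ ≤ C)
    (x : BoundedFamily H U) (i : ι) : map T hT x i = T i (x i) := rfl

variable [∀ i, InnerProductSpace ℝ (H i)]

noncomputable instance : Module ℝ (BoundedFamily H U) :=
  inferInstanceAs (Module ℝ (lp H ⊤))

theorem smul_apply (r : ℝ) (x : BoundedFamily H U) (i : ι) : (r • x) i = r • x i := rfl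

theorem exists_tendsto_inner (x y : BoundedFamily H U) :
    ∃ l, Tendsto (fun i => inner ℝ (x i) (y i)) U (𝓝 l) := by
  obtain ⟨C, hC⟩ := x.exists_norm_le
  obtain ⟨D, hD⟩ := y.exists_norm_le
  exact U.exists_tendsto_of_bounded fun i => (abs_real_inner_le_norm _ _).trans
    (mul_le_mul (hC i) (hD i) (norm_nonneg _) ((norm_nonneg _).trans (hC i)))

noncomputable instance : PreInnerProductSpace.Core ℝ (BoundedFamily H U) where
  inner x y := (exists_tendsto_inner x y).choose
  conj_inner_symm x y := by
    refine tendsto_nhds_unique (exists_tendsto_inner y x).choose_spec ?_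
    simpa only [real_inner_comm] using (exists_tendsto_inner x y).choose_spec
  re_inner_nonneg x :=
    ge_of_tendsto' (exists_tendsto_inner x x).choose_spec fun i => real_inner_self_nonneg
  add_left x y z := by
    refine tendsto_nhds_unique (exists_tendsto_inner (x + y) z).choose_spec ?_
    simpa only [add_apply, inner_add_left] using
      (exists_tendsto_inner x z).choose_spec.add (exists_tendsto_inner y z).choose_spec
  smul_left x y r := by
    refine tendsto_nhds_unique (exists_tendsto_inner (r • x) y).choose_spec ?_
    simpa only [smul_apply, real_inner_smul_left, conj_trivial] using
      (exists_tendsto_inner x y).choose_spec.const_mul r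

noncomputable instance : SeminormedAddCommGroup (BoundedFamily H U) :=
  InnerProductSpace.Core.toSeminormedAddCommGroup (𝕜 := ℝ)

noncomputable instance : InnerProductSpace ℝ (BoundedFamily H U) :=
  InnerProductSpace.ofCore inferInstance

theorem tendsto_inner (x y : BoundedFamily H U) :
    Tendsto (fun i => inner ℝ (x i) (y i)) U (𝓝 (inner ℝ x y)) :=
  (exists_tendsto_inner x y).choose_spec

theorem tendsto_dist (x y : BoundedFamily H U) :
    Tendsto (fun i => dist (x i) (y i)) U (𝓝 (dist x y)) := by
  have h := (tendsto_inner (x - y) (x - y)).sqrt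
  simpa only [sub_apply, real_inner_self_eq_norm_sq, Real.sqrt_sq, norm_nonneg,
    ← dist_eq_norm, dist_nonneg] using h

theorem isometry_map (T : ∀ i, H i ≃ᵢ H i) (hT : ∃ C, ∀ i, ‖T i 0‖ ≤ C) :
    Isometry (map T hT : BoundedFamily H U → BoundedFamily H U) := by
  refine Isometry.of_dist_eq fun x y => tendsto_nhds_unique (tendsto_dist _ _) ?_
  simpa only [map_apply, IsometryEquiv.dist_eq] using tendsto_dist x y

end BoundedFamily

/-- In a family of isometric actions of a group, the elements moving the origins by a bounded
amount form a subgroup. -/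
theorem exists_norm_apply_zero_le_of_closure {F : Type*} [Group F] {H : ι → Type*}
    [∀ i, NormedAddCommGroup (H i)] (T : ∀ i, F →* (H i ≃ᵢ H i)) {S : Set F}
    (hS : Subgroup.closure S = ⊤) (h : ∀ s ∈ S, ∃ C, ∀ i, ‖T i s 0‖ ≤ C) (a : F) :
    ∃ C, ∀ i, ‖T i a 0‖ ≤ C := by
  induction (hS ▸ Subgroup.mem_top a : a ∈ Subgroup.closure S) using
    Subgroup.closure_induction with
  | mem s hs => exact h s hs
  | one => exact ⟨0, fun i => by simp⟩
  | mul a b _ _ ha hb =>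
    obtain ⟨C, hC⟩ := ha
    obtain ⟨D, hD⟩ := hb
    refine ⟨D + C, fun i => ?_⟩
    calc ‖T i (a * b) 0‖ = dist (T i a (T i b 0)) 0 := by simp
      _ ≤ dist (T i a (T i b 0)) (T i a 0) + dist (T i a 0) 0 := dist_triangle _ _ _
      _ ≤ D + C := by
        rw [(T i a).dist_eq, dist_zero_right, dist_zero_right]
        exact add_le_add (hD i) (hC i)
  | inv a _ ha =>
    obtain ⟨C, hC⟩ := ha
    refine ⟨C, fun i => ?_⟩
    have h_eq : dist (T i a⁻¹ 0) 0 = dist (T i a 0) 0 := by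
      rw [← (T i a).dist_eq, ← IsometryEquiv.mul_apply, ← map_mul, mul_inv_cancel, map_one,
        IsometryEquiv.coe_one, id, dist_comm]
    rw [← dist_zero_right, h_eq, dist_zero_right]
    exact hC i

/-- Let isometric actions of `F` on Hilbert spaces be given that asymptotically factor through a
quotient `G` of `F` with Property (T). If a finite generating set of `F` moves the origins by a
bounded amount, then it cannot move uniformly all points of balls of radius going to infinity. -/
theorem PropertyT.exists_sum_dist_lt {F G : Type*} [Group F] [Group G] (hG : PropertyT G)
    {φ : F →* G} (hφ : Function.Surjective φ) {α : Type*} [Fintype α] (s : α → F)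
    (hs : Subgroup.closure (Set.range s) = ⊤) {H : ℕ → Type} [∀ k, NormedAddCommGroup (H k)]
    [∀ k, InnerProductSpace ℝ (H k)] (T : ∀ k, F →* (H k ≃ᵢ H k))
    (hT : ∀ a, φ a = 1 → ∀ᶠ k in atTop, T k a = 1) {C : ℝ}
    (hC : ∀ k j, ‖T k (s j) 0‖ ≤ C) {ε : ℝ} (hε : 0 < ε) :
    ∃ k, ∃ v : H k, ‖v‖ ≤ k ∧ ∑ j, dist (T k (s j) v) v < ε := by
  by_contra! h_far
  let U : Ultrafilter ℕ := hyperfilter ℕ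
  have hU : (U : Filter ℕ) ≤ atTop := Nat.hyperfilter_le_atTop
  have h_bdd := exists_norm_apply_zero_le_of_closure T hs
    (by rintro _ ⟨j, rfl⟩; exact ⟨C, fun k => hC k j⟩)
  let V := BoundedFamily H U
  let A : F → V → V := fun a => BoundedFamily.map (fun k => T k a) (h_bdd a)
  have hA_apply (a : F) (v : V) (k : ℕ) : A a v k = T k a (v k) := rfl
  have hA_iso (a : F) : Isometry (A a) := BoundedFamily.isometry_map _ _
  have hA_mul (a b : F) (v : V) : A (a * b) v = A a (A b v) := by
    ext k; simp [hA_apply]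
  have hA_eq {a b : F} (hab : φ a = φ b) (v : V) : dist (A a v) (A b v) = 0 := by
    refine tendsto_nhds_unique (BoundedFamily.tendsto_dist _ _)
      (tendsto_const_nhds.congr' ?_)
    have h_one : φ (a * b⁻¹) = 1 := by rw [map_mul, map_inv, hab, mul_inv_cancel]
    filter_upwards [hU (hT _ h_one)] with k hk
    rw [map_mul, map_inv, mul_inv_eq_one] at hk
    rw [hA_apply, hA_apply, hk, dist_self]
  let B : F → UniformSpace.Completion V → UniformSpace.Completion V :=
    fun a => UniformSpace.Completion.map (A a)
  have hB_coe (a : F) (v : V) : B a v = (A a v : V) :=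
    UniformSpace.Completion.map_coe (hA_iso a).uniformContinuous v
  have hB_iso (a : F) : Isometry (B a) := (hA_iso a).completion_map
  have hB_eq {a b : F} (hab : φ a = φ b) : B a = B b := by
    refine UniformSpace.Completion.ext (hB_iso a).continuous (hB_iso b).continuous fun v => ?_
    rw [hB_coe, hB_coe, ← dist_eq_zero, UniformSpace.Completion.dist_eq, hA_eq hab]
  have hB_one (w) : B 1 w = w := by
    refine congrFun (UniformSpace.Completion.ext (g := id) (hB_iso 1).continuous continuous_id
      fun v => ?_) w
    rw [hB_coe, id]
    congr 1
    ext k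
    simp [hA_apply]
  have hB_mul (a b : F) (w) : B (a * b) w = B a (B b w) := by
    refine congrFun (UniformSpace.Completion.ext (g := B a ∘ B b) (hB_iso _).continuous
      ((hB_iso a).comp (hB_iso b)).continuous fun v => ?_) w
    simp only [Function.comp_apply, hB_coe, hA_mul]
  let σ := Function.surjInv hφ
  have hσ (g : G) : φ (σ g) = g := Function.surjInv_eq hφ g
  obtain ⟨w, hw⟩ := hG.exists_fixedPoint (isometryActionHom (fun g => B (σ g))
    (fun w => by rw [hB_eq (b := 1) (by rw [hσ, map_one]), hB_one])
    (fun g h w => by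
      rw [← hB_mul, hB_eq (a := σ (g * h)) (b := σ g * σ h) (by simp only [map_mul, hσ])])
    (fun g => hB_iso _))
  have hBw (a : F) : B a w = w := by
    rw [hB_eq (hσ (φ a)).symm]
    exact hw (φ a)
  have h_cont : Continuous fun w => ∑ j, dist (B (s j) w) w :=
    continuous_finsetSum _ fun j _ => (hB_iso _).continuous.dist continuous_id
  have h_open : IsOpen {w | ∑ j, dist (B (s j) w) w < ε} := isOpen_lt h_cont continuous_const
  obtain ⟨_, hv, v, rfl⟩ := UniformSpace.Completion.denseRange_coe.inter_open_nonempty _ h_open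
    ⟨w, by simpa [hBw] using hε⟩
  have h_lim : Tendsto (fun k => ∑ j, dist (T k (s j) (v k)) (v k)) U
      (𝓝 (∑ j, dist (A (s j) v) v)) :=
    tendsto_finsetSum _ fun j _ => BoundedFamily.tendsto_dist (A (s j) v) v
  simp only [Set.mem_ofPred_eq, hB_coe, UniformSpace.Completion.dist_eq] at hv
  refine hv.not_ge (ge_of_tendsto h_lim ?_)
  obtain ⟨D, hD⟩ := v.exists_norm_le
  filter_upwards [hU (eventually_ge_atTop ⌈D⌉₊)] with k hk
  exact h_far k _ ((hD k).trans (Nat.ceil_le.mp hk))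

end Ultraproduct

section Renormalization

/-- If `D` is a positive continuous function on a complete space, there are points where it is at
most twice as large as at all points of a ball whose radius is proportional to the value. -/
theorem exists_half_le_on_ball {X : Type*} [MetricSpace X] [CompleteSpace X] [Nonempty X]
    {D : X → ℝ} (hD : Continuous D) (hD_pos : ∀ x, 0 < D x) {R : ℝ} (hR : 0 ≤ R) :
    ∃ x, ∀ y, dist x y ≤ R * D x → D x / 2 ≤ D y := by
  by_contra! h
  choose f hf_dist hf_lt using h
  let x : ℕ → X := fun n => f^[n] (Classical.arbitrary X)
  have hx (n : ℕ) : x (n + 1) = f (x n) := Function.iterate_succ_apply' f n _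
  have h_le (n : ℕ) : D (x n) ≤ D (x 0) / 2 ^ n := by
    induction n with
    | zero => simp
    | succ n ih =>
      rw [hx, pow_succ, ← div_div]
      linarith [hf_lt (x n)]
  have h_dist (n : ℕ) : dist (x n) (x (n + 1)) ≤ 2 * (R * D (x 0)) / 2 / 2 ^ n := by
    rw [hx]
    refine (hf_dist _).trans ((mul_le_mul_of_nonneg_left (h_le n) hR).trans_eq ?_)
    ring
  obtain ⟨l, hl⟩ := cauchySeq_tendsto_of_complete (cauchySeq_of_le_geometric_two h_dist)
  have h_zero : Tendsto (fun n => D (x n)) atTop (𝓝 0) := by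
    refine squeeze_zero (fun n => (hD_pos _).le) h_le ?_
    simpa [div_eq_mul_inv, inv_pow] using
      (tendsto_pow_atTop_nhds_zero_of_lt_one (r := (2 : ℝ)⁻¹) (by norm_num)
        (by norm_num)).const_mul (D (x 0))
  exact (hD_pos l).ne' (tendsto_nhds_unique ((hD.tendsto l).comp hl) h_zero)

/-- An isometric action without fixed points can be recentred and rescaled, so that a finite
generating set has displacement one at the origin and at least `1 / 2` on a large ball. -/
theorem exists_renormalized_action {F : Type*} [Group F] {α : Type*} [Fintype α] (s : α → F)
    (hs : Subgroup.closure (Set.range s) = ⊤) {H : Type*} [NormedAddCommGroup H]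
    [NormedSpace ℝ H] [CompleteSpace H] (ρ : F →* (H ≃ᵢ H)) (hρ : ∀ x, ∃ a, ρ a x ≠ x)
    {R : ℝ} (hR : 0 ≤ R) :
    ∃ T : F →* (H ≃ᵢ H), (∀ a, ρ a = 1 → T a = 1) ∧ (∀ j, ‖T (s j) 0‖ ≤ 1) ∧
      ∀ v, ‖v‖ ≤ R → 1 / 2 ≤ ∑ j, dist (T (s j) v) v := by
  let D : H → ℝ := fun x => ∑ j, dist (ρ (s j) x) x
  have hD : Continuous D :=
    continuous_finsetSum _ fun j _ => (ρ (s j)).continuous.dist continuous_id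
  have hD_nonneg (x : H) : 0 ≤ D x := Finset.sum_nonneg fun j _ => dist_nonneg
  have hD_pos (x : H) : 0 < D x := by
    refine (hD_nonneg x).lt_of_ne' fun h_zero => ?_
    have h_fix : ∀ j, ρ (s j) x = x := fun j => dist_eq_zero.mp
      ((Finset.sum_eq_zero_iff_of_nonneg fun j _ => dist_nonneg).mp h_zero j (Finset.mem_univ j))
    obtain ⟨a, ha⟩ := hρ x
    refine ha ?_
    clear ha
    induction (hs ▸ Subgroup.mem_top a : a ∈ Subgroup.closure (Set.range s)) using
      Subgroup.closure_induction with
    | mem _ h => obtain ⟨j, rfl⟩ := h; exact h_fix j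
    | one => simp
    | mul a b _ _ iha ihb => rw [map_mul, IsometryEquiv.mul_apply, ihb, iha]
    | inv a _ iha =>
      refine (ρ a).injective ?_
      rw [← IsometryEquiv.mul_apply, ← map_mul, mul_inv_cancel, map_one, IsometryEquiv.coe_one, id,
        iha]
  obtain ⟨x, hx⟩ := exists_half_le_on_ball hD hD_pos hR
  set r := D x with hr
  have hr_pos : 0 < r := hD_pos x
  let T : F → H → H := fun a v => r⁻¹ • (ρ a (x + r • v) - x)
  have hT (a : F) (v w : H) : dist (T a v) w = r⁻¹ * dist (ρ a (x + r • v)) (x + r • w) := by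
    have : T a v - w = r⁻¹ • (ρ a (x + r • v) - (x + r • w)) := by
      simp only [T, smul_sub, smul_add, inv_smul_smul₀ hr_pos.ne']
      abel
    rw [dist_eq_norm, this, norm_smul, Real.norm_of_nonneg (inv_nonneg.mpr hr_pos.le),
      dist_eq_norm]
  have hxT (a : F) (v : H) : x + r • T a v = ρ a (x + r • v) := by
    simp only [T, smul_inv_smul₀ hr_pos.ne', add_sub_cancel]
  have hT_of_one {a : F} (ha : ρ a = 1) (v : H) : T a v = v := by
    simp [T, ha, inv_smul_smul₀ hr_pos.ne']
  refine ⟨isometryActionHom T (hT_of_one (map_one ρ)) (fun a b v => ?_) (fun a => ?_),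
    fun a ha => IsometryEquiv.ext (hT_of_one ha), fun j => ?_, fun v hv => ?_⟩
  · simp only [T, map_mul, IsometryEquiv.mul_apply, smul_inv_smul₀ hr_pos.ne', add_sub_cancel]
  · refine Isometry.of_dist_eq fun v w => ?_
    rw [hT, hxT, (ρ a).dist_eq, dist_add_left, dist_smul₀, Real.norm_of_nonneg hr_pos.le,
      inv_mul_cancel_left₀ hr_pos.ne']
  · rw [isometryActionHom_apply, ← dist_zero_right, hT, smul_zero, add_zero,
      inv_mul_le_iff₀ hr_pos, mul_one]
    exact Finset.single_le_sum (f := fun j => dist (ρ (s j) x) x) (fun _ _ => dist_nonneg)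
      (Finset.mem_univ j)
  · simp only [isometryActionHom_apply, hT, ← Finset.mul_sum]
    have := hx (x + r • v) (by
      rw [dist_self_add_right, norm_smul, Real.norm_of_nonneg hr_pos.le, mul_comm]
      exact mul_le_mul_of_nonneg_right hv hr_pos.le)
    rw [le_inv_mul_iff₀ hr_pos]
    linarith

end Renormalization

/-- **Shalom's theorem.** Every countable discrete group with Kazhdan's Property (T) is a
quotient of a finitely presented group with Property (T). -/
theorem shalom_finitely_presented_cover (G : Type) [Group G] [Countable G]
    (hG : PropertyT G) :
    ∃ (G₀ : Type) (_ : Group G₀), FinitelyPresented G₀ ∧ PropertyT G₀ ∧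
      ∃ φ : G₀ →* G, Function.Surjective φ := by
  obtain ⟨α, _, φ', hφ'⟩ := Group.fg_iff_exists_freeGroup_hom_surjective_finite.mp hG.group_fg
  let n := Nat.card α
  let φ : FreeGroup (Fin n) →* G :=
    φ'.comp (FreeGroup.freeGroupCongr (Finite.equivFin α)).symm.toMonoidHom
  have hφ : Function.Surjective φ := hφ'.comp (MulEquiv.surjective _)
  obtain ⟨e, he⟩ := exists_surjective_nat (FreeGroup (Fin n))
  let rels : ℕ → Set (FreeGroup (Fin n)) := fun k => (e '' Set.Iio k) ∩ φ.ker
  have h_fin (k : ℕ) : (rels k).Finite := ((Set.finite_Iio k).image e).inter_of_left _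
  suffices h : ∃ k, PropertyT (PresentedGroup (rels k)) by
    obtain ⟨k, hk⟩ := h
    refine ⟨PresentedGroup (rels k), inferInstance, ⟨n, rels k, h_fin k, ⟨MulEquiv.refl _⟩⟩, hk,
      QuotientGroup.lift _ φ (Subgroup.normalClosure_le_normal Set.inter_subset_right), ?_⟩
    exact QuotientGroup.lift_surjective_of_surjective _ φ hφ _
  by_contra! h
  have hs : Subgroup.closure (Set.range (FreeGroup.of (α := Fin n))) = ⊤ :=
    FreeGroup.closure_range_of _
  have h_act (k : ℕ) : ∃ (H : Type) (_ : NormedAddCommGroup H) (_ : InnerProductSpace ℝ H)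
      (T : FreeGroup (Fin n) →* (H ≃ᵢ H)), (∀ r ∈ rels k, T r = 1) ∧
      (∀ j, ‖T (FreeGroup.of j) 0‖ ≤ 1) ∧
      ∀ v, ‖v‖ ≤ k → 1 / 2 ≤ ∑ j, dist (T (FreeGroup.of j) v) v := by
    have hk := h k
    simp only [PropertyT, not_forall, not_exists] at hk
    obtain ⟨H, _, _, _, ρ, hρ⟩ := hk
    let ρ' : FreeGroup (Fin n) →* (H ≃ᵢ H) := isometryActionHom
      (fun a => ρ (PresentedGroup.mk _ a)) (fun x => by simp) (fun a b x => by simp)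
      (fun a => (ρ _).isometry)
    obtain ⟨T, hT, hT'⟩ := exists_renormalized_action FreeGroup.of hs ρ' (fun x => by
      obtain ⟨g, hg⟩ := hρ x
      obtain ⟨a, rfl⟩ := PresentedGroup.mk_surjective _ g
      exact ⟨a, hg⟩) k.cast_nonneg
    refine ⟨H, ‹_›, ‹_›, T, fun r hr => hT r (IsometryEquiv.ext fun x => ?_), hT'⟩
    have h_one : PresentedGroup.mk (rels k) r = 1 := PresentedGroup.one_of_mem hr
    simp [ρ', h_one]
  choose H _ _ T hT_rels hT_zero hT_far using h_act
  obtain ⟨k, v, hv, hv_lt⟩ := hG.exists_sum_dist_lt hφ FreeGroup.of hs T (fun a ha => by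
    obtain ⟨i, rfl⟩ := he a
    filter_upwards [eventually_gt_atTop i] with k hk
    exact hT_rels k _ ⟨⟨i, hk, rfl⟩, ha⟩) hT_zero one_half_pos
  exact (hT_far k v hv).not_gt hv_lt
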